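/- Let (T,d,μ) be a semi-measured real tree, α its associated projection, and ν the push-forward of μ along α, a Borel probability measure on Core(T)×[0,∞). Then D = (Core(T), d, ν) is a long dendron; that is, Core(T) with the restriction of d is a real tree, and for every branch B of Core(T) one has ν(B×[0,∞)) > 0. -/

import Mathlib

open scoped NNReal ENNReal

noncomputable section

/-- `(T,d)` is a real tree: a nonempty complete metric space in which any two distinct
points are joined by an isometric arc all of whose intermediate points separate them. -/
def IsRealTree (T : Type*) [MetricSpace T] : Prop :=
  Nonempty T ∧ CompleteSpace T ∧
    ∀ p q : T, p ≠ q → ∃ a b : ℝ, a < b ∧ ∃ α : ℝ → T,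
      (∀ s ∈ Set.Icc a b, ∀ t ∈ Set.Icc a b, dist (α s) (α t) = |s - t|) ∧
      α a = p ∧ α b = q ∧
      ∀ c : ℝ, a < c → c < b →
        connectedComponentIn ({α c}ᶜ) p ≠ connectedComponentIn ({α c}ᶜ) q

/-- `S` is the segment `[x,y]`. -/
def IsSegment {T : Type*} [MetricSpace T] (x y : T) (S : Set T) : Prop :=
  ∃ a b : ℝ, a ≤ b ∧ ∃ α : ℝ → T,
    (∀ s ∈ Set.Icc a b, ∀ t ∈ Set.Icc a b, dist (α s) (α t) = |s - t|) ∧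
    α a = x ∧ α b = y ∧ S = α '' Set.Icc a b ∧
    ∀ c : ℝ, a < c → c < b →
      connectedComponentIn ({α c}ᶜ) x ≠ connectedComponentIn ({α c}ᶜ) y

/-- `B` is a `p`-branch: a connected component of `T \ {p}`. -/
def IsBranchAt {T : Type*} [MetricSpace T] (p : T) (B : Set T) : Prop :=
  ∃ x : T, x ≠ p ∧ B = connectedComponentIn ({p}ᶜ) x

/-- `B` is a branch of `T`. -/
def IsBranch {T : Type*} [MetricSpace T] (B : Set T) : Prop :=
  ∃ p : T, IsBranchAt p B

/-- A subtree: a nonempty, closed, connected subset. -/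
def IsSubtree {T : Type*} [MetricSpace T] (Y : Set T) : Prop :=
  Y.Nonempty ∧ IsClosed Y ∧ IsPreconnected Y

/-- The sampling map `ρ_r`. -/
def rho {X : Type*} (d : X → X → ℝ) (r : ℕ) (x : Fin r → X) : Fin r → Fin r → ℝ :=
  fun i j => if i = j then 0 else d (x i) (x j)

/-- The sampling measure `τ_r(X,d,μ)`: push-forward of `μ^r` along `ρ_r`. -/
def samplingMeasure {X : Type*} [MeasurableSpace X] (d : X → X → ℝ) (r : ℕ)
    (μ : MeasureTheory.Measure X) : MeasureTheory.Measure (Fin r → Fin r → ℝ) :=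
  MeasureTheory.Measure.map (rho d r) (MeasureTheory.Measure.pi fun _ => μ)

/-- Weak convergence of a sequence of measures. -/
def WeakTendsto {Ω : Type*} [MeasurableSpace Ω] [TopologicalSpace Ω]
    (μ : ℕ → MeasureTheory.Measure Ω) (ν : MeasureTheory.Measure Ω) : Prop :=
  ∀ g : BoundedContinuousFunction Ω ℝ,
    Filter.Tendsto (fun n => ∫ x, g x ∂(μ n)) Filter.atTop (nhds (∫ x, g x ∂ν))

/-- A point `p` is an inner point if no `p`-branch has full measure. -/
def IsInnerPoint {T : Type*} [MetricSpace T] [MeasurableSpace T]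
    (μ : MeasureTheory.Measure T) (p : T) : Prop :=
  ¬ ∃ B : Set T, IsBranchAt p B ∧ μ B = 1

/-- The core: the closure of the set of inner points. -/
def treeCore {T : Type*} [MetricSpace T] [MeasurableSpace T]
    (μ : MeasureTheory.Measure T) : Set T :=
  closure {p : T | IsInnerPoint μ p}

/-- Feathers: the connected components of `T \ Core(T)`. -/
def IsFeather {T : Type*} [MetricSpace T] [MeasurableSpace T]
    (μ : MeasureTheory.Measure T) (F : Set T) : Prop :=
  ∃ x : T, x ∉ treeCore μ ∧ F = connectedComponentIn ((treeCore μ)ᶜ) x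

/-- A long dendron: a real tree together with a Borel probability measure on
`A_D = T × [0,∞)` giving positive mass to `B × [0,∞)` for every branch `B` of `T`. -/
structure LongDendron where
  carrier : Type
  [met : MetricSpace carrier]
  [meas : MeasurableSpace carrier]
  [borelSpace : BorelSpace carrier]
  isRealTree : IsRealTree carrier
  ν : MeasureTheory.Measure (carrier × ℝ≥0)
  isProb : MeasureTheory.IsProbabilityMeasure ν
  branch_pos : ∀ B : Set carrier, IsBranch B → 0 < ν (B ×ˢ Set.univ)

attribute [instance] LongDendron.met LongDendron.meas LongDendron.borelSpace

/-- `d_D((u,a),(v,b)) = d(u,v) + a + b`. -/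
def LongDendron.dD (D : LongDendron) (x y : D.carrier × ℝ≥0) : ℝ :=
  dist x.1 y.1 + (x.2 : ℝ) + (y.2 : ℝ)

/-- `τ_r(D)` for a long dendron `D`. -/
def LongDendron.samp (D : LongDendron) (r : ℕ) :
    MeasureTheory.Measure (Fin r → Fin r → ℝ) :=
  samplingMeasure D.dD r D.ν

/-- A dendron: a long dendron with `d_D ≤ 1` `ν²`-almost surely. -/
def LongDendron.IsDendron (D : LongDendron) : Prop :=
  (D.ν.prod D.ν) {x : (D.carrier × ℝ≥0) × (D.carrier × ℝ≥0) | 1 < D.dD x.1 x.2} = 0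

/-- The (combinatorial) diameter of a finite graph. -/
def graphDiam {V : Type*} [Fintype V] (G : SimpleGraph V) : ℕ :=
  Finset.sup Finset.univ fun p : V × V => G.dist p.1 p.2

/-- The shortest path distance normalized by the diameter. -/
def treeDist {V : Type*} [Fintype V] (G : SimpleGraph V) (u v : V) : ℝ :=
  (G.dist u v : ℝ) / (graphDiam G : ℝ)

/-- `τ_r(T)` for a finite tree: sampling from the uniform measure on the vertex set
with the normalized distance. -/
def treeSamp {V : Type*} [Fintype V] (G : SimpleGraph V) (r : ℕ) :
    MeasureTheory.Measure (Fin r → Fin r → ℝ) :=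
  @samplingMeasure V ⊤ (treeDist G) r
    ((Fintype.card V : ℝ≥0∞)⁻¹ • @MeasureTheory.Measure.count V ⊤)

/-- `(T,d,μ)` is an `A`-tree. -/
def IsATree {T : Type*} [MetricSpace T] [MeasurableSpace T] (n : ℕ)
    (A : Fin n → Fin n → ℝ) (μ : MeasureTheory.Measure T) : Prop :=
  ∃ q : Fin n → T,
    (∀ i j : Fin n, (if i = j then (0 : ℝ) else dist (q i) (q j)) = A i j) ∧
    (∀ Y : Set T, IsSubtree Y → (∀ i, q i ∈ Y) → Y = Set.univ) ∧
    (∀ H : Set T, MeasurableSet H →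
      μ H = ({i : Fin n | q i ∈ H}.ncard : ℝ≥0∞) / (n : ℝ≥0∞))

end

noncomputable section

/-- The associated projection `α(p) = (π(p), d(p, π(p)))` into `Core(T) × [0,∞)`,
for a given nearest-point retraction `π` onto the core. -/
def assocProj {T : Type*} [MetricSpace T] [MeasurableSpace T]
    (μ : MeasureTheory.Measure T) (π : T → T) (hπ : ∀ t, π t ∈ treeCore μ) :
    T → ↥(treeCore μ) × ℝ≥0 :=
  fun p => (⟨π p, hπ p⟩, ⟨dist p (π p), dist_nonneg⟩)

/-- The Borel σ-algebra on `Core(T) × [0,∞)` (the core carrying the restricted metric). -/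
def coreBorel {T : Type*} [MetricSpace T] [MeasurableSpace T]
    (μ : MeasureTheory.Measure T) : MeasurableSpace (↥(treeCore μ) × ℝ≥0) :=
  borel _

/-- The measure of the associated long dendron: push-forward of `μ` along the
associated projection. -/
def assocNu {T : Type*} [MetricSpace T] [MeasurableSpace T]
    (μ : MeasureTheory.Measure T) (π : T → T) (hπ : ∀ t, π t ∈ treeCore μ) :
    @MeasureTheory.Measure (↥(treeCore μ) × ℝ≥0) (coreBorel μ) :=
  letI : MeasurableSpace (↥(treeCore μ) × ℝ≥0) := coreBorel μ
  MeasureTheory.Measure.map (assocProj μ π hπ) μ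

/-- `d_D` for the associated long dendron of a semi-measured real tree. -/
def coreDD {T : Type*} [MetricSpace T] [MeasurableSpace T]
    (μ : MeasureTheory.Measure T) (x y : ↥(treeCore μ) × ℝ≥0) : ℝ :=
  dist (x.1 : T) (y.1 : T) + (x.2 : ℝ) + (y.2 : ℝ)

end

open MeasureTheory Metric Filter Topology Set
open scoped NNReal ENNReal

noncomputable section

/-- metric betweenness -/
def TBtw {T : Type*} [MetricSpace T] (x z y : T) : Prop := dist x z + dist z y = dist x y

theorem TBtw.symm {T : Type*} [MetricSpace T] {x z y : T} (h : TBtw x z y) : TBtw y z x := by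
  unfold TBtw at *
  rw [dist_comm y z, dist_comm z x, dist_comm y x]; linarith

theorem geod {T : Type*} [MetricSpace T] (hT : IsRealTree T) (p q : T) :
    ∃ C : Set T, IsPreconnected C ∧ p ∈ C ∧ q ∈ C ∧ (∀ z ∈ C, TBtw p z q) ∧
      (∀ r : ℝ, 0 ≤ r → r ≤ dist p q → ∃ z ∈ C, dist p z = r) ∧
      ∀ K : Set T, IsPreconnected K → p ∈ K → q ∈ K → C ⊆ K := by
  by_cases hpq : p = q
  · subst hpq
    refine ⟨{p}, isPreconnected_singleton, rfl, rfl, ?_, ?_, ?_⟩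
    · rintro z rfl; simp [TBtw]
    · intro r h0 h1
      refine ⟨p, rfl, ?_⟩
      rw [dist_self] at *; linarith
    · rintro K - hp - z rfl; exact hp
  obtain ⟨a, b, hab, α, hiso, rfl, rfl, hsep⟩ := hT.2.2 p q hpq
  have ha : a ∈ Icc a b := ⟨le_rfl, hab.le⟩
  have hb : b ∈ Icc a b := ⟨hab.le, le_rfl⟩
  have hc : ContinuousOn α (Icc a b) := by
    refine LipschitzOnWith.continuousOn (K := 1) (LipschitzOnWith.of_dist_le_mul ?_)
    intro s hs t ht
    rw [hiso s hs t ht, Real.dist_eq]; simp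
  refine ⟨α '' Icc a b, isPreconnected_Icc.image α hc, ⟨a, ha, rfl⟩, ⟨b, hb, rfl⟩, ?_, ?_, ?_⟩
  · rintro _ ⟨c, hc, rfl⟩
    unfold TBtw
    rw [hiso a ha c hc, hiso c hc b hb, hiso a ha b hb, abs_of_nonpos (by linarith [hc.1]),
      abs_of_nonpos (by linarith [hc.2]), abs_of_nonpos (by linarith)]
    ring
  · intro r h0 h1
    rw [hiso a ha b hb, abs_of_nonpos (by linarith)] at h1
    have hr : a + r ∈ Icc a b := ⟨by linarith, by linarith⟩
    refine ⟨α (a + r), ⟨_, hr, rfl⟩, ?_⟩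
    rw [hiso a ha _ hr, abs_of_nonpos (by linarith)]; ring
  · rintro K hK hp hq _ ⟨c, hc, rfl⟩
    rcases eq_or_lt_of_le hc.1 with rfl | h1
    · exact hp
    rcases eq_or_lt_of_le hc.2 with rfl | h2
    · exact hq
    by_contra hn
    have hsub : K ⊆ {α c}ᶜ := by
      intro y hy h
      rw [mem_singleton_iff] at h
      exact hn (h ▸ hy)
    exact hsep c h1 h2 (connectedComponentIn_eq (hK.subset_connectedComponentIn hp hsub hq))

theorem tbtw_mem {T : Type*} [MetricSpace T] (hT : IsRealTree T) {p z q : T} (h : TBtw p z q)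
    {K : Set T} (hK : IsPreconnected K) (hp : p ∈ K) (hq : q ∈ K) : z ∈ K := by
  obtain ⟨C1, c1, p1, q1, b1, -, -⟩ := geod hT p z
  obtain ⟨C2, c2, p2, q2, b2, -, -⟩ := geod hT z q
  obtain ⟨C, c, pp, qq, bb, rr, kk⟩ := geod hT p q
  unfold TBtw at *
  obtain ⟨w, hw, hwd⟩ := rr (dist p z) dist_nonneg (by linarith [dist_nonneg (x := z) (y := q)])
  have hwz : z = w := by
    rcases kk _ (c1.union z q1 p2 c2) (Or.inl p1) (Or.inr q2) hw with h' | h'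
    · have := b1 w h'
      exact (dist_le_zero.1 (by linarith)).symm
    · have := b2 w h'
      have := bb w hw
      exact (dist_le_zero.1 (by linarith))
  rw [hwz]
  exact kk K hK hp hq hw

theorem seg_preconn {T : Type*} [MetricSpace T] (hT : IsRealTree T) (p q : T) :
    IsPreconnected {z | TBtw p z q} := by
  obtain ⟨C, c, pp, qq, bb, rr, kk⟩ := geod hT p q
  have : {z | TBtw p z q} = C := by
    ext z
    exact ⟨fun h => tbtw_mem hT h c pp qq, bb z⟩
  rw [this]; exact c

theorem tbtw_left {T : Type*} [MetricSpace T] (p q : T) : TBtw p p q := by simp [TBtw]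
theorem tbtw_right {T : Type*} [MetricSpace T] (p q : T) : TBtw p q q := by simp [TBtw]

theorem tbtw_exists {T : Type*} [MetricSpace T] (hT : IsRealTree T) (p q : T) (r : ℝ)
    (h0 : 0 ≤ r) (h1 : r ≤ dist p q) : ∃ z, TBtw p z q ∧ dist p z = r := by
  obtain ⟨C, c, pp, qq, bb, rr, kk⟩ := geod hT p q
  obtain ⟨z, hz, h⟩ := rr r h0 h1
  exact ⟨z, bb z hz, h⟩

theorem tbtw_or {T : Type*} [MetricSpace T] (hT : IsRealTree T) {x p z : T} (y : T)
    (h : TBtw x p z) : TBtw x p y ∨ TBtw y p z :=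
  tbtw_mem hT h ((seg_preconn hT x y).union y (tbtw_right x y) (tbtw_left y z) (seg_preconn hT y z))
    (Or.inl (tbtw_left x y)) (Or.inr (tbtw_right y z))

theorem seg_closed {T : Type*} [MetricSpace T] (p q : T) : IsClosed {z | TBtw p z q} :=
  isClosed_eq (by fun_prop) (by fun_prop)

theorem median {T : Type*} [MetricSpace T] (hT : IsRealTree T) (x y z : T) :
    ∃ m, TBtw x m y ∧ TBtw x m z ∧ TBtw z m y := by
  obtain ⟨m, h1, h2, h3⟩ := isPreconnected_closed_iff.1 (seg_preconn hT x y) _ _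
    (seg_closed x z) (seg_closed z y) (fun w hw => tbtw_or hT z hw)
    ⟨x, tbtw_left x y, tbtw_left x z⟩ ⟨y, tbtw_right x y, tbtw_right z y⟩
  exact ⟨m, h1, h2, h3⟩

theorem comp_eq {T : Type*} [MetricSpace T] (hT : IsRealTree T) {x p : T} (hx : x ≠ p) :
    connectedComponentIn ({p}ᶜ) x = {y | ¬ TBtw x p y} := by
  ext y
  constructor
  · intro hy h
    exact connectedComponentIn_subset _ _
      (tbtw_mem hT h isPreconnected_connectedComponentIn (mem_connectedComponentIn hx) hy) rfl
  · intro h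
    refine (seg_preconn hT x y).subset_connectedComponentIn (tbtw_left x y) ?_ (tbtw_right x y)
    intro z hz hzp
    rw [mem_singleton_iff] at hzp
    exact h (hzp ▸ hz)

theorem nb_open {T : Type*} [MetricSpace T] (x p : T) : IsOpen {y | ¬ TBtw x p y} := by
  have : IsClosed {y | TBtw x p y} := isClosed_eq (by fun_prop) (by fun_prop)
  exact this.isOpen_compl

theorem nb_self {T : Type*} [MetricSpace T] {x p : T} (h : x ≠ p) : ¬ TBtw x p x := by
  unfold TBtw
  rw [dist_self, dist_comm p x]
  intro h'
  exact h (dist_le_zero.1 (by linarith))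

theorem nb_ne {T : Type*} [MetricSpace T] {x p y : T} (h : ¬ TBtw x p y) : y ≠ p := by
  rintro rfl; exact h (tbtw_right x y)

section meas
variable {T : Type} [MetricSpace T] [m : MeasurableSpace T]

theorem meas_dist (hballs : ∀ (x : T) (s : ℝ), MeasurableSet (Metric.ball x s)) (x : T) :
    Measurable (fun y => dist x y) := by
  refine measurable_of_Iio fun s => ?_
  convert hballs x s using 1
  ext y; simp [dist_comm]

theorem meas_nb (hballs : ∀ (x : T) (s : ℝ), MeasurableSet (Metric.ball x s)) (x p : T) :
    MeasurableSet {y | ¬ TBtw x p y} :=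
  (measurableSet_eq_fun ((meas_dist hballs p).const_add _) (meas_dist hballs x)).compl

theorem inner_ne (hT : IsRealTree T) {μ : Measure T} {w : T} (hw : IsInnerPoint μ w) {x : T}
    (hx : x ≠ w) : μ {y | ¬ TBtw x w y} ≠ 1 := fun h =>
  hw ⟨_, ⟨x, hx, rfl⟩, by rw [comp_eq hT hx, h]⟩

theorem branch_pos' (hT : IsRealTree T) (μ : Measure T) [IsProbabilityMeasure μ]
    (hballs : ∀ (x : T) (s : ℝ), MeasurableSet (Metric.ball x s)) {c x : T}
    (hx : x ∈ treeCore μ) (hxc : x ≠ c) : 0 < μ {y | ¬ TBtw x c y} := by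
  obtain ⟨w, hwV, hw⟩ := mem_closure_iff.1 hx _ (nb_open x c) (nb_self hxc)
  rw [pos_iff_ne_zero]
  intro h0
  have h1 : μ {y | ¬ TBtw x c y}ᶜ = 1 := by
    rw [prob_compl_eq_one_iff (meas_nb hballs x c)]; exact h0
  refine inner_ne hT hw (nb_ne hwV).symm (le_antisymm prob_le_one ?_)
  rw [← h1]
  refine measure_mono fun y hy => ?_
  simp only [mem_compl_iff, mem_setOf_eq, not_not] at hy hwV ⊢
  intro h
  apply hwV
  unfold TBtw at *
  linarith [dist_triangle x c w, dist_triangle x w y]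

theorem inner_of_btw (hT : IsRealTree T) (μ : Measure T) [IsProbabilityMeasure μ]
    {p z q : T} (hp : p ∈ treeCore μ) (hq : q ∈ treeCore μ) (h : TBtw p z q)
    (hzp : p ≠ z) (hzq : q ≠ z) : IsInnerPoint μ z := by
  obtain ⟨p', hp'V, hp'⟩ := mem_closure_iff.1 hp _ (nb_open p z) (nb_self hzp)
  obtain ⟨q', hq'V, hq'⟩ := mem_closure_iff.1 hq _ (nb_open q z) (nb_self hzq)
  have key : ∀ x p' : T, IsInnerPoint μ p' → p' ≠ z → TBtw x z p' →
      μ {y | ¬ TBtw x z y} ≠ 1 := by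
    intro x p' hp' hne hb h1
    refine inner_ne hT hp' hne.symm (le_antisymm prob_le_one ?_)
    rw [← h1]
    refine measure_mono fun y hy => ?_
    simp only [mem_setOf_eq] at hy ⊢
    intro h
    rcases tbtw_or hT y hb with h' | h'
    · exact hy h'
    · apply hne
      unfold TBtw at *
      rw [dist_comm y z, dist_comm y p'] at h'
      exact (dist_le_zero.1 (by linarith [dist_comm z p']))
  rintro ⟨B, ⟨x, hx, rfl⟩, h1⟩
  rw [comp_eq hT hx] at h1
  simp only [mem_setOf_eq] at hp'V hq'V
  have hb : TBtw p' z q' := by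
    rcases tbtw_or hT p' h with h' | h'
    · exact absurd h' hp'V
    · rcases tbtw_or hT q' h' with h'' | h''
      · exact h''
      · exact absurd h''.symm hq'V
  rcases tbtw_or hT x hb with h' | h'
  · exact key x p' hp' (nb_ne hp'V) h'.symm h1
  · exact key x q' hq' (nb_ne hq'V) h' h1

theorem core_convex (hT : IsRealTree T) (μ : Measure T) [IsProbabilityMeasure μ]
    {p z q : T} (hp : p ∈ treeCore μ) (hq : q ∈ treeCore μ) (h : TBtw p z q) :
    z ∈ treeCore μ := by
  by_cases hzp : p = z
  · exact hzp ▸ hp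
  by_cases hzq : q = z
  · exact hzq ▸ hq
  exact subset_closure (inner_of_btw hT μ hp hq h hzp hzq)

theorem core_tree (hT : IsRealTree T) (μ : Measure T) [IsProbabilityMeasure μ]
    (hne : (treeCore μ).Nonempty) : IsRealTree ↥(treeCore μ) := by
  have := hT.2.1
  refine ⟨hne.to_subtype, (isClosed_closure : IsClosed (treeCore μ)).completeSpace_coe, ?_⟩
  rintro ⟨p, hp⟩ ⟨q, hq⟩ hpq
  have hpq' : p ≠ q := fun h => hpq (Subtype.ext h)
  obtain ⟨a, b, hab, α, hiso, rfl, rfl, hsep⟩ := hT.2.2 p q hpq'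
  have ha : a ∈ Icc a b := ⟨le_rfl, hab.le⟩
  have hb : b ∈ Icc a b := ⟨hab.le, le_rfl⟩
  have hmem : ∀ c ∈ Icc a b, α c ∈ treeCore μ := by
    intro c hc
    refine core_convex hT μ hp hq ?_
    unfold TBtw
    rw [hiso a ha c hc, hiso c hc b hb, hiso a ha b hb, abs_of_nonpos (by linarith [hc.1]),
      abs_of_nonpos (by linarith [hc.2]), abs_of_nonpos (by linarith)]
    ring
  classical
  let β : ℝ → treeCore μ := fun c => if hc : c ∈ Icc a b then ⟨α c, hmem c hc⟩ else ⟨α a, hp⟩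
  have hβ : ∀ c (hc : c ∈ Icc a b), β c = ⟨α c, hmem c hc⟩ := fun c hc => dif_pos hc
  refine ⟨a, b, hab, β, ?_, hβ a ha, hβ b hb, ?_⟩
  · intro s hs t ht
    rw [hβ s hs, hβ t ht]; exact hiso s hs t ht
  · intro c h1 h2 heq
    have hc : c ∈ Icc a b := ⟨h1.le, h2.le⟩
    rw [hβ c hc] at heq
    have hac : α a ≠ α c := by
      intro h
      have := hiso a ha c hc
      rw [h, dist_self] at this
      have := abs_eq_zero.1 this.symm
      linarith
    have hbc : α b ≠ α c := by
      intro h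
      have := hiso b hb c hc
      rw [h, dist_self] at this
      have := abs_eq_zero.1 this.symm
      linarith
    have hmA : (⟨α b, hq⟩ : treeCore μ) ∈
        connectedComponentIn ({(⟨α c, hmem c hc⟩ : treeCore μ)}ᶜ) ⟨α a, hp⟩ := by
      rw [heq]
      apply mem_connectedComponentIn
      intro h
      exact hbc (congrArg Subtype.val h)
    have hmB := mem_connectedComponentIn (F := ({(⟨α c, hmem c hc⟩ : treeCore μ)}ᶜ))
      (x := ⟨α a, hp⟩) (fun h => hac (congrArg Subtype.val h))
    have hK := (isPreconnected_connectedComponentIn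
      (F := ({(⟨α c, hmem c hc⟩ : treeCore μ)}ᶜ)) (x := ⟨α a, hp⟩)).image Subtype.val
      continuous_subtype_val.continuousOn
    refine hsep c h1 h2 (connectedComponentIn_eq
      (hK.subset_connectedComponentIn ⟨_, hmB, rfl⟩ ?_ ⟨_, hmA, rfl⟩))
    rintro _ ⟨y, hy, rfl⟩ h
    exact connectedComponentIn_subset _ _ hy (Subtype.ext h)

theorem core_sep (hT : IsRealTree T) (μ : Measure T) [IsProbabilityMeasure μ]
    (hballs : ∀ (x : T) (s : ℝ), MeasurableSet (Metric.ball x s)) :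
    TopologicalSpace.IsSeparable (treeCore μ) := by
  rcases hT.1 with ⟨o⟩
  let S : ℝ → Set T := fun r => {y | dist o y = r ∧ ∃ x ∈ treeCore μ, TBtw o y x ∧ x ≠ y}
  have hS : ∀ r, (S r).Countable := by
    intro r
    let U : S r → Set T := fun y => {t | TBtw o y.1 t} \ {t | dist y.1 t = 0}
    have hUm : ∀ y, MeasurableSet (U y) := by
      intro y
      refine MeasurableSet.diff ?_ ?_
      · exact measurableSet_eq_fun ((meas_dist hballs y.1).const_add _) (meas_dist hballs o)
      · exact (meas_dist hballs y.1) (measurableSet_singleton 0)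
    have hUd : Pairwise (Function.onFun Disjoint U) := by
      intro y z hyz
      refine Set.disjoint_left.2 ?_
      rintro t ⟨h1, -⟩ ⟨h2, -⟩
      apply hyz
      apply Subtype.ext
      have e1 := y.2.1
      have e2 := z.2.1
      simp only [mem_setOf_eq] at h1 h2
      have h3 := tbtw_mem hT h1 ((seg_preconn hT o z.1).union z.1 (tbtw_right _ _) (tbtw_left _ _)
        (seg_preconn hT z.1 t)) (Or.inl (tbtw_left _ _)) (Or.inr (tbtw_right _ _))
      rcases h3 with h3 | h3
      · simp only [mem_setOf_eq, TBtw] at *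
        exact dist_le_zero.1 (by linarith)
      · simp only [mem_setOf_eq, TBtw] at *
        exact (dist_le_zero.1 (by linarith)).symm
    have hUp : ∀ y, 0 < μ (U y) := by
      rintro ⟨y, hyr, x, hx, hb, hne⟩
      refine (branch_pos' hT μ hballs hx hne).trans_le (measure_mono ?_)
      intro t ht
      simp only [mem_setOf_eq] at ht
      refine ⟨?_, fun h => nb_ne ht (dist_eq_zero.1 h).symm⟩
      rcases tbtw_or hT t hb with h | h
      · exact h
      · exact absurd h.symm ht
    have := Measure.countable_meas_pos_of_disjoint_iUnion (μ := μ) hUm hUd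
    have huniv : {i | 0 < μ (U i)} = univ := by ext i; simp [hUp i]
    rw [huniv] at this
    exact Set.countable_coe_iff.1 (Set.countable_univ_iff.1 this)
  refine ⟨{o} ∪ ⋃ r : ℚ, S r, (countable_singleton o).union (countable_iUnion fun r => hS r), ?_⟩
  intro x hx
  rw [Metric.mem_closure_iff]
  intro ε hε
  by_cases hxo : x = o
  · exact ⟨o, Or.inl rfl, by simpa [hxo] using hε⟩
  have hd : 0 < dist o x := dist_pos.2 (Ne.symm hxo)
  obtain ⟨r, h1, h2⟩ := exists_rat_btwn (show max 0 (dist o x - ε) < dist o x from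
    max_lt hd (by linarith))
  obtain ⟨h3, h4⟩ := max_lt_iff.1 h1
  obtain ⟨z, hz, hzr⟩ := tbtw_exists hT o x r h3.le h2.le
  have hz' := hz
  unfold TBtw at hz'
  refine ⟨z, Or.inr (mem_iUnion.2 ⟨r, hzr, x, hx, hz, ?_⟩), ?_⟩
  · rintro rfl; linarith
  · rw [dist_comm]; linarith

theorem proj_btw (hT : IsRealTree T) (μ : Measure T) [IsProbabilityMeasure μ]
    (π : T → T) (hπY : ∀ t, π t ∈ treeCore μ)
    (hπ : ∀ t, ∀ y ∈ treeCore μ, dist t (π t) ≤ dist t y) (t c : T) (hc : c ∈ treeCore μ) :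
    TBtw t (π t) c := by
  obtain ⟨m, h1, h2, h3⟩ := median hT t c (π t)
  have hm := core_convex hT μ (hπY t) hc h3
  have := hπ t m hm
  have h2' := h2
  unfold TBtw at h2'
  have : m = π t := dist_le_zero.1 (by linarith)
  exact this ▸ h1

theorem proj_meas (hT : IsRealTree T) (μ : Measure T) [IsProbabilityMeasure μ]
    (hballs : ∀ (x : T) (s : ℝ), MeasurableSet (Metric.ball x s))
    (π : T → T) (hπY : ∀ t, π t ∈ treeCore μ)
    (hπ : ∀ t, ∀ y ∈ treeCore μ, dist t (π t) ≤ dist t y) :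
    @Measurable _ _ m (coreBorel μ) (assocProj μ π hπY) := by
  have hsep := (core_sep hT μ hballs).separableSpace
  have : SecondCountableTopology (treeCore μ) := UniformSpace.secondCountable_of_separable _
  letI : MeasurableSpace (treeCore μ) := borel _
  haveI : BorelSpace (treeCore μ) := ⟨rfl⟩
  have hcb : coreBorel μ = (inferInstance : MeasurableSpace (treeCore μ × ℝ≥0)) :=
    (BorelSpace.measurable_eq (α := treeCore μ × ℝ≥0)).symm
  rw [hcb]
  haveI : Nonempty (treeCore μ) := let ⟨o⟩ := hT.1; ⟨⟨π o, hπY o⟩⟩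
  have hdist : Measurable fun t => dist t (π t) := by
    refine measurable_of_Iio fun s => ?_
    have : (fun t => dist t (π t)) ⁻¹' Iio s =
        ⋃ n : ℕ, Metric.ball (TopologicalSpace.denseSeq (treeCore μ) n : T) s := by
      ext t
      simp only [mem_preimage, mem_Iio, mem_iUnion, Metric.mem_ball]
      constructor
      · intro h
        have hd := TopologicalSpace.denseRange_denseSeq (treeCore μ)
        obtain ⟨n, hn⟩ := hd.exists_dist_lt (⟨π t, hπY t⟩ : treeCore μ)
          (show 0 < s - dist t (π t) by linarith)
        rw [Subtype.dist_eq] at hn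
        refine ⟨n, ?_⟩
        have := dist_triangle t (π t) (TopologicalSpace.denseSeq (treeCore μ) n : T)
        simp only at hn
        linarith
      · rintro ⟨n, hn⟩
        exact (hπ t _ (TopologicalSpace.denseSeq (treeCore μ) n).2).trans_lt hn
    rw [this]
    exact MeasurableSet.iUnion fun n => hballs _ _
  refine Measurable.prodMk ?_ (hdist.subtype_mk)
  refine measurable_of_isOpen fun O hO => ?_
  have hd := TopologicalSpace.denseRange_denseSeq (treeCore μ)
  have hOeq : O = ⋃ (n : ℕ) (r : ℚ)
      (_ : Metric.ball (TopologicalSpace.denseSeq (treeCore μ) n) r ⊆ O),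
      Metric.ball (TopologicalSpace.denseSeq (treeCore μ) n) (r : ℝ) := by
    apply Subset.antisymm
    · intro x hx
      obtain ⟨ε, hε, hb⟩ := Metric.isOpen_iff.1 hO x hx
      obtain ⟨r, hr0, hr⟩ := exists_rat_btwn (show (0 : ℝ) < ε / 2 by linarith)
      obtain ⟨n, hn⟩ := hd.exists_dist_lt x hr0
      simp only [mem_iUnion]
      refine ⟨n, r, ?_, hn⟩
      intro y hy
      apply hb
      rw [Metric.mem_ball] at *
      have := dist_triangle y (TopologicalSpace.denseSeq (treeCore μ) n) x
      rw [dist_comm (TopologicalSpace.denseSeq (treeCore μ) n) x] at this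
      linarith
    · exact iUnion_subset fun n => iUnion_subset fun r => iUnion_subset fun h => h
  rw [hOeq]
  simp only [preimage_iUnion]
  refine MeasurableSet.iUnion fun n => MeasurableSet.iUnion fun r => MeasurableSet.iUnion fun _ => ?_
  set c := TopologicalSpace.denseSeq (treeCore μ) n
  have : (fun t => (⟨π t, hπY t⟩ : treeCore μ)) ⁻¹' Metric.ball c r =
      {t | dist (c : T) t - dist t (π t) < r} := by
    ext t
    have := proj_btw hT μ π hπY hπ t c c.2
    unfold TBtw at this
    rw [dist_comm t c] at this
    simp only [mem_preimage, Metric.mem_ball, Subtype.dist_eq, mem_setOf_eq]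
    constructor <;> intro h <;> linarith
  rw [this]
  exact measurableSet_lt ((meas_dist hballs _).sub hdist) measurable_const

end meas

/-- The associated long dendron of a semi-measured real tree is indeed a long
dendron: the core is a real tree, and every branch of the core carries positive
`ν`-mass. -/
theorem statement12 {T : Type} [MetricSpace T] [m : MeasurableSpace T]
    (hT : IsRealTree T) (μ : Measure T) [IsProbabilityMeasure μ]
    (hballs : ∀ (x : T) (s : ℝ), MeasurableSet (Metric.ball x s))
    (π : T → T) (hπY : ∀ t, π t ∈ treeCore μ)
    (hπ : ∀ t, ∀ y ∈ treeCore μ, dist t (π t) ≤ dist t y) :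
    IsRealTree ↥(treeCore μ) ∧
    ∀ B : Set ↥(treeCore μ), IsBranch B →
      0 < assocNu μ π hπY (B ×ˢ Set.univ) := by
  have hne : (treeCore μ).Nonempty := let ⟨o⟩ := hT.1; ⟨π o, hπY o⟩
  have hC := core_tree hT μ hne
  refine ⟨hC, ?_⟩
  rintro B ⟨c, x, hx, rfl⟩
  rw [comp_eq hC hx]
  have hm := proj_meas hT μ hballs π hπY hπ
  have hx' : (x : T) ≠ c := fun h => hx (Subtype.ext h)
  have hpos := branch_pos' hT μ hballs x.2 hx'
  unfold assocNu
  letI : MeasurableSpace (↥(treeCore μ) × ℝ≥0) := coreBorel μ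
  haveI : BorelSpace (↥(treeCore μ) × ℝ≥0) := ⟨rfl⟩
  have hms : MeasurableSet ({y : treeCore μ | ¬ TBtw x c y} ×ˢ (univ : Set ℝ≥0)) :=
    ((nb_open x c).prod isOpen_univ).measurableSet
  rw [Measure.map_apply hm hms]
  refine hpos.trans_le (measure_mono ?_)
  intro t ht
  simp only [mem_setOf_eq] at ht
  refine ⟨?_, mem_univ _⟩
  change ¬ TBtw (x : T) (c : T) (π t)
  intro hb
  have hb2 : TBtw t c (π t) := by
    rcases tbtw_or hT t hb with h | h
    · exact absurd h ht
    · exact h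
  obtain ⟨m', h1, h2, h3⟩ := median hT (c : T) x t
  have hmc := core_convex hT μ c.2 x.2 h1
  have hmne : m' ≠ c := by
    rintro rfl
    exact ht h3.symm
  have := hπ t m' hmc
  have hd := dist_pos.2 hmne
  unfold TBtw at *
  linarith [dist_comm t m', dist_comm t c, dist_comm m' (c : T), dist_nonneg (x := (c : T)) (y := π t)]

end
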